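/- Let A be a finite central arrangement in an ℓ-dimensional Euclidean space and m : A → ℤ a multiplicity with m(H) ≥ 0 for all H ∈ A. Then Ω(A,m) coincides with Ziegler's module: Ω(A,m) = {ω ∈ Ω_F : (∏_{H∈A} α_H^{m(H)}) ω and (∏_{H ≠ H₀} α_H^{m(H)}) (dα_{H₀} ∧ ω) are both regular for all H₀ ∈ A}. -/

import Mathlib

open MvPolynomial

noncomputable section CoxeterFormalization

/-! ### The ambient rings: `S = Sym(V*)`, `F = Frac(S)`, rational 1-forms.

We model the `ℓ`-dimensional Euclidean space `V` as `ℝ^ℓ` with its standard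
(orthonormal) coordinates, so that `S = ℝ[x_0, …, x_{ℓ-1}]`, and a rational
differential 1-form `ω = Σ ω_x dx_x` (equivalently, a rational derivation
`ξ = Σ ξ_x ∂_x`) is recorded by its component vector `(ω_x)_x : Fin ℓ → F`. -/

abbrev Spoly (ℓ : ℕ) := MvPolynomial (Fin ℓ) ℝ
abbrev Ffield (ℓ : ℕ) := FractionRing (Spoly ℓ)
abbrev OmF (ℓ : ℕ) := Fin ℓ → Ffield ℓ

variable {ℓ t : ℕ}

/-- The image of `S` in `F`: the "regular" (polynomial) rational functions. -/
def Sreg (ℓ : ℕ) : Set (Ffield ℓ) := Set.range (algebraMap (Spoly ℓ) (Ffield ℓ))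

def toF (p : Spoly ℓ) : Ffield ℓ := algebraMap (Spoly ℓ) (Ffield ℓ) p

/-- The linear form `α = Σ a_x · x_x ∈ V*` attached to a normal vector `a`. -/
def linForm (a : Fin ℓ → ℝ) : Spoly ℓ := ∑ x, MvPolynomial.C (a x) * MvPolynomial.X x

def linF (a : Fin ℓ → ℝ) : Ffield ℓ := toF (linForm a)

def cF (r : ℝ) : Ffield ℓ := toF (MvPolynomial.C r)

def XF (x : Fin ℓ) : Ffield ℓ := toF (MvPolynomial.X x)

/-- `Q = ∏_{H ∈ A} α_H`, as an element of `F`. -/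
def QF (A : Finset (Fin ℓ → ℝ)) : Ffield ℓ := toF (∏ a ∈ A, linForm a)

/-- `Q^m = ∏_{H ∈ A} α_H^{m(H)}` for an integral multiplicity `m`. -/
def QmF (A : Finset (Fin ℓ → ℝ)) (m : (Fin ℓ → ℝ) → ℤ) : Ffield ℓ :=
  ∏ a ∈ A, linF a ^ m a

/-- Ziegler's module `Ω(A,∞)` of logarithmic 1-forms:
`Q^N ω` and `(Q/α_H)^N dα_H ∧ ω` regular for `N ≫ 0`.  The wedge
`dα_H ∧ ω` is recorded by its components `a_x ω_y - a_y ω_x`. -/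
def OmegaInf (A : Finset (Fin ℓ → ℝ)) : Set (OmF ℓ) :=
  {ω | ∃ N : ℕ,
    (∀ x, QF A ^ N * ω x ∈ Sreg ℓ) ∧
    ∀ a ∈ A, ∀ x y,
      (QF A / linF a) ^ N * (cF (a x) * ω y - cF (a y) * ω x) ∈ Sreg ℓ}

/-- `Ω(A,m)` for an arbitrary multiplicity `m : A → ℤ`: those `ω ∈ Ω(A,∞)` with
`(Q/α_H)^N α_H^{m(H)} I*(dα_H, ω) ∈ S` for `N ≫ 0`; here
`I*(dα_H, ω) = Σ_x a_x ω_x` (the coordinates are orthonormal). -/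
def OmegaMult (A : Finset (Fin ℓ → ℝ)) (m : (Fin ℓ → ℝ) → ℤ) : Set (OmF ℓ) :=
  {ω ∈ OmegaInf A | ∃ N : ℕ,
    ∀ a ∈ A, (QF A / linF a) ^ N * linF a ^ m a * (∑ x, cF (a x) * ω x) ∈ Sreg ℓ}

/-! ### The action of `GL_ℓ(ℝ)` on `S`, `F` and on component vectors. -/

/-- Substitution `x_i ↦ Σ_j M_{i j} x_j`, i.e. `f ↦ f ∘ M`. -/
def matSub (M : Matrix (Fin ℓ) (Fin ℓ) ℝ) : Spoly ℓ →ₐ[ℝ] Spoly ℓ :=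
  MvPolynomial.aeval fun x => ∑ y, MvPolynomial.C (M x y) * MvPolynomial.X y

lemma matSub_comp (M N : Matrix (Fin ℓ) (Fin ℓ) ℝ) :
    (matSub M).comp (matSub N) = matSub (N * M) := by
  apply MvPolynomial.algHom_ext
  intro x
  simp only [matSub, AlgHom.coe_comp, Function.comp_apply, aeval_X, map_sum, map_mul, aeval_C,
    Matrix.mul_apply, C_mul, Finset.sum_mul, Finset.mul_sum, MvPolynomial.algebraMap_eq,
    mul_assoc]
  rw [Finset.sum_comm]

lemma matSub_one : matSub (1 : Matrix (Fin ℓ) (Fin ℓ) ℝ) = AlgHom.id ℝ (Spoly ℓ) := by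
  apply MvPolynomial.algHom_ext
  intro x
  simp [matSub, Matrix.one_apply, apply_ite MvPolynomial.C, ite_mul, Finset.sum_ite_eq]

lemma matSub_injective (g : Matrix.GeneralLinearGroup (Fin ℓ) ℝ) :
    Function.Injective (matSub (↑g : Matrix (Fin ℓ) (Fin ℓ) ℝ)) := by
  intro p q h
  have h3 : (matSub (↑g⁻¹ : Matrix (Fin ℓ) (Fin ℓ) ℝ)).comp
      (matSub (↑g : Matrix (Fin ℓ) (Fin ℓ) ℝ)) = AlgHom.id ℝ (Spoly ℓ) := by
    rw [matSub_comp]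
    have h1 : ((↑g : Matrix (Fin ℓ) (Fin ℓ) ℝ) * (↑g⁻¹ : Matrix (Fin ℓ) (Fin ℓ) ℝ))
        = (1 : Matrix (Fin ℓ) (Fin ℓ) ℝ) := by
      rw [← Units.val_mul]; simp
    rw [h1, matSub_one]
  have h2 := congrArg (matSub (↑g⁻¹ : Matrix (Fin ℓ) (Fin ℓ) ℝ)) h
  rwa [← AlgHom.comp_apply, ← AlgHom.comp_apply, h3, AlgHom.id_apply, AlgHom.id_apply] at h2

/-- The action of `g ∈ GL_ℓ(ℝ)` on rational functions, `f ↦ f ∘ g⁻¹`. -/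
def fAct (g : Matrix.GeneralLinearGroup (Fin ℓ) ℝ) : Ffield ℓ →+* Ffield ℓ :=
  IsFractionRing.lift (g :=
    (algebraMap (Spoly ℓ) (Ffield ℓ)).comp
      (matSub (↑g⁻¹ : Matrix (Fin ℓ) (Fin ℓ) ℝ)).toRingHom)
    ((IsFractionRing.injective (Spoly ℓ) (Ffield ℓ)).comp (matSub_injective g⁻¹))

/-- The natural action of an **orthogonal** `g` on the component vector of a
differential 1-form (equivalently, of a derivation): `(g·v)_x = Σ_y g_{x y} · g(v_y)`. -/
def vecAct (g : Matrix.GeneralLinearGroup (Fin ℓ) ℝ) (v : OmF ℓ) : OmF ℓ :=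
  fun x => ∑ y, cF ((↑g : Matrix (Fin ℓ) (Fin ℓ) ℝ) x y) * fAct g (v y)

/-- `W`-invariant component vectors (1-forms/derivations). -/
def InvVec (W : Subgroup (Matrix.GeneralLinearGroup (Fin ℓ) ℝ)) : Set (OmF ℓ) :=
  {ω | ∀ g ∈ W, vecAct g ω = ω}

/-- `Ω(A,∞)^W`. -/
def OmegaInfW (A : Finset (Fin ℓ → ℝ)) (W : Subgroup (Matrix.GeneralLinearGroup (Fin ℓ) ℝ)) :
    Set (OmF ℓ) := OmegaInf A ∩ InvVec W

/-- `Ω(A,m)^W = Ω(A,m) ∩ Ω(A,∞)^W`. -/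
def OmegaMultW (A : Finset (Fin ℓ → ℝ)) (W : Subgroup (Matrix.GeneralLinearGroup (Fin ℓ) ℝ))
    (m : (Fin ℓ → ℝ) → ℤ) : Set (OmF ℓ) := OmegaMult A m ∩ InvVec W

/-- `W`-invariant polynomials. -/
def InvPoly (W : Subgroup (Matrix.GeneralLinearGroup (Fin ℓ) ℝ)) : Set (Spoly ℓ) :=
  {p | ∀ g ∈ W, matSub (↑g : Matrix (Fin ℓ) (Fin ℓ) ℝ) p = p}

/-- The invariant ring `R = S^W`, viewed inside `F`. -/
def RF (W : Subgroup (Matrix.GeneralLinearGroup (Fin ℓ) ℝ)) : Set (Ffield ℓ) :=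
  toF '' InvPoly W

/-- The orthogonal reflection through the hyperplane `ker⟨a, ·⟩`. -/
def reflMat (a : Fin ℓ → ℝ) : Matrix (Fin ℓ) (Fin ℓ) ℝ :=
  1 - (2 / ∑ x, a x * a x) • Matrix.vecMulVec a a

/-! ### Block (irreducible-factor) structure. -/

/-- A polynomial involving only the variables of the block `i` (w.r.t. the block
assignment `blk : Fin ℓ → Fin t`). -/
def blockPoly (blk : Fin ℓ → Fin t) (i : Fin t) (p : Spoly ℓ) : Prop :=
  ∀ m ∈ p.support, ∀ x ∈ Finsupp.support m, blk x = i

/-- Rational functions in the variables of block `i` only. -/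
def blockFrac (blk : Fin ℓ → Fin t) (i : Fin t) : Set (Ffield ℓ) :=
  {y | ∃ p q : Spoly ℓ, blockPoly blk i p ∧ blockPoly blk i q ∧ q ≠ 0 ∧ y * toF q = toF p}

/-- A component vector belonging to the factor `V[i]`:  components outside block `i`
vanish and all components are rational functions of the block-`i` variables. -/
def BlockVec (blk : Fin ℓ → Fin t) (i : Fin t) (ω : OmF ℓ) : Prop :=
  (∀ x, blk x ≠ i → ω x = 0) ∧ ∀ x, ω x ∈ blockFrac blk i

/-- All the data of a (not necessarily irreducible) Coxeter arrangement `A` in the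
Euclidean space `V = ℝ^ℓ`, together with its decomposition into `t` irreducible
factors and a system of basic invariants:

* `A` is a finite set of hyperplanes, recorded by nonzero defining normal vectors,
  pairwise non-proportional;
* `W` is a finite subgroup of `GL_ℓ(ℝ)` consisting of orthogonal transformations,
  generated by the reflections through the members of `A`, and `A` is exactly the
  set of reflecting hyperplanes of `W` (so `A` is the Coxeter arrangement of the
  finite real reflection group `W`);
* `blk` assigns to every coordinate its irreducible block `V[i]`, every hyperplane
  of `A` lies over a single block;
* `P c` (`c : Fin ℓ`) are basic invariants: homogeneous, `W`-invariant,
  algebraically independent generators of `R = S^W`, the invariants of the block `i`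
  being those `P c` with `blk c = i` and involving only block-`i` variables;
* within each block `i` the invariant `P (top i)` has strictly largest degree
  (this uses irreducibility of the factors; it makes the primitive derivations
  `D[i] = ∂/∂P_{ℓ[i]}[i]` well defined up to constants). -/
structure CoxeterSetup (ℓ t : ℕ) where
  A : Finset (Fin ℓ → ℝ)
  W : Subgroup (Matrix.GeneralLinearGroup (Fin ℓ) ℝ)
  hA0 : ∀ a ∈ A, a ≠ 0
  hAprop : ∀ a ∈ A, ∀ b ∈ A, (∃ c : ℝ, a = c • b) → a = b
  hWfin : (W : Set (Matrix.GeneralLinearGroup (Fin ℓ) ℝ)).Finite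
  hWorth : ∀ g ∈ W, Matrix.transpose (↑g : Matrix (Fin ℓ) (Fin ℓ) ℝ) * (↑g : Matrix (Fin ℓ) (Fin ℓ) ℝ) = 1
  hrefl : ∀ a ∈ A, ∃ g ∈ W, (↑g : Matrix (Fin ℓ) (Fin ℓ) ℝ) = reflMat a
  hhyp : ∀ g ∈ W, ∀ a : Fin ℓ → ℝ, a ≠ 0 → (↑g : Matrix (Fin ℓ) (Fin ℓ) ℝ) = reflMat a →
    ∃ b ∈ A, ∃ c : ℝ, a = c • b
  hgen : W = Subgroup.closure
    {g : Matrix.GeneralLinearGroup (Fin ℓ) ℝ | ∃ a ∈ A, (↑g : Matrix (Fin ℓ) (Fin ℓ) ℝ) = reflMat a}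
  blk : Fin ℓ → Fin t
  hblkA : ∀ a ∈ A, ∃ i, ∀ x, a x ≠ 0 → blk x = i
  P : Fin ℓ → MvPolynomial (Fin ℓ) ℝ
  deg : Fin ℓ → ℕ
  hdeg : ∀ c, 0 < deg c
  hPhom : ∀ c, (P c).IsHomogeneous (deg c)
  hPblock : ∀ c, blockPoly blk (blk c) (P c)
  hPinv : ∀ c, P c ∈ InvPoly W
  hPind : AlgebraicIndependent ℝ P
  hPgen : ∀ p : Spoly ℓ, p ∈ InvPoly W ↔ p ∈ Algebra.adjoin ℝ (Set.range P)
  top : Fin t → Fin ℓ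
  htop : ∀ i, blk (top i) = i
  htopdeg : ∀ i c, blk c = i → c ≠ top i → deg c < deg (top i)

/-! ### Primitive derivations and the connection `∇_D`. -/

/-- The covariant derivative `∇_D` on rational 1-forms: since `∇_D (dx_x) = 0`,
it acts componentwise, `∇_D(Σ f_x dx_x) = Σ D(f_x) dx_x`. -/
def nabVec (D : Derivation ℝ (Ffield ℓ) (Ffield ℓ)) (ω : OmF ℓ) : OmF ℓ :=
  fun x => D (ω x)

/-- `T = ker (D : R → R)`, viewed inside `F`. -/
def TF (W : Subgroup (Matrix.GeneralLinearGroup (Fin ℓ) ℝ))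
    (D : Derivation ℝ (Ffield ℓ) (Ffield ℓ)) : Set (Ffield ℓ) :=
  {y ∈ RF W | D y = 0}

/-- The differential `dP` of a polynomial, as a component vector: `(dP)_x = ∂P/∂x_x`. -/
def dPoly (p : Spoly ℓ) : OmF ℓ := fun x => toF (MvPolynomial.pderiv x p)

/-! ### Freeness of a submodule over a subring of coefficients. -/

/-- `v : ι → M` is a basis of the sub-`C`-module `Mod ⊆ M` over the coefficient
set `C ⊆ F`: the members of the family lie in `Mod`, every element of `Mod`
is a finite `C`-linear combination of them, and they are linearly independent
over `C`. -/
def IsBasisOver {ℓ : ℕ} {ι M : Type*} [AddCommMonoid M] [Module (Ffield ℓ) M]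
    (C : Set (Ffield ℓ)) (Mod : Set M) (v : ι → M) : Prop :=
  (∀ j, v j ∈ Mod) ∧
  (∀ ω ∈ Mod, ∃ c : ι →₀ Ffield ℓ, (∀ j, c j ∈ C) ∧ ω = c.sum fun j a => a • v j) ∧
  (∀ c : ι →₀ Ffield ℓ, (∀ j, c j ∈ C) → (c.sum fun j a => a • v j) = 0 → c = 0)

/-! ### Order of poles along a hyperplane. -/

/-- The localization `S_{(α)}` of `S` at the prime ideal `(α)`, viewed in `F`:
fractions with denominator prime to `α`. -/
def Sloc (a : Fin ℓ → ℝ) : Set (Ffield ℓ) :=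
  {y | ∃ p q : Spoly ℓ, ¬ linForm a ∣ q ∧ y * toF q = toF p}

/-- `ordEq a f k` says `ord_α(f) = k`, i.e. `k = min {j : α^j f ∈ S_{(α)}}`. -/
def ordEq (a : Fin ℓ → ℝ) (f : Ffield ℓ) (k : ℤ) : Prop :=
  linF a ^ k * f ∈ Sloc a ∧ ∀ j : ℤ, linF a ^ j * f ∈ Sloc a → k ≤ j

/-! ### Logarithmic derivation modules. -/

/-- The module `D(A,−∞)` of logarithmic derivations (Definition 4.1):
`Q^N ξ` regular and `(Q/α_H)^N ξ(β)` regular whenever `β ⊥ α_H`. -/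
def DerInf (A : Finset (Fin ℓ → ℝ)) : Set (Derivation ℝ (Ffield ℓ) (Ffield ℓ)) :=
  {ξ | ∃ N : ℕ,
    (∀ x, QF A ^ N * ξ (XF x) ∈ Sreg ℓ) ∧
    ∀ a ∈ A, ∀ b : Fin ℓ → ℝ, (∑ x, a x * b x) = 0 →
      (QF A / linF a) ^ N * ξ (linF b) ∈ Sreg ℓ}

/-- `D(A,m)` for a multiplicity `m : A → ℤ`:
`(Q/α_H)^N ξ(α_H) ∈ α_H^{m(H)} S` for `N ≫ 0`. -/
def DerMult (A : Finset (Fin ℓ → ℝ)) (m : (Fin ℓ → ℝ) → ℤ) :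
    Set (Derivation ℝ (Ffield ℓ) (Ffield ℓ)) :=
  {ξ ∈ DerInf A | ∃ N : ℕ, ∀ a ∈ A, ∃ p : Spoly ℓ,
    (QF A / linF a) ^ N * ξ (linF a) = linF a ^ m a * toF p}

/-- The component vector of a derivation: `ξ = Σ_x ξ(x_x) ∂_x`. -/
def derVec (ξ : Derivation ℝ (Ffield ℓ) (Ffield ℓ)) : OmF ℓ := fun x => ξ (XF x)

/-- `W`-invariant derivations (via the action on component vectors; the group
consists of orthogonal transformations). -/
def InvDer (W : Subgroup (Matrix.GeneralLinearGroup (Fin ℓ) ℝ)) :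
    Set (Derivation ℝ (Ffield ℓ) (Ffield ℓ)) :=
  {ξ | ∀ g ∈ W, vecAct g (derVec ξ) = derVec ξ}

/-- `D(A,−∞)^W`. -/
def DerInfW (A : Finset (Fin ℓ → ℝ)) (W : Subgroup (Matrix.GeneralLinearGroup (Fin ℓ) ℝ)) :
    Set (Derivation ℝ (Ffield ℓ) (Ffield ℓ)) := DerInf A ∩ InvDer W

/-- `D(A,m)^W = D(A,m) ∩ D(A,−∞)^W`. -/
def DerMultW (A : Finset (Fin ℓ → ℝ)) (W : Subgroup (Matrix.GeneralLinearGroup (Fin ℓ) ℝ))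
    (m : (Fin ℓ → ℝ) → ℤ) : Set (Derivation ℝ (Ffield ℓ) (Ffield ℓ)) :=
  DerMult A m ∩ InvDer W

/-- `I* : Ω_F → Der_F`, `I*(ω)(f) = I*(ω, df) = Σ_x ω_x ∂f/∂x_x`, defined using a
family `pd` of partial-derivative derivations of `F`. -/
def IstarDer (pd : Fin ℓ → Derivation ℝ (Ffield ℓ) (Ffield ℓ)) (ω : OmF ℓ) :
    Derivation ℝ (Ffield ℓ) (Ffield ℓ) :=
  ∑ x, ω x • pd x

/-- The covariant derivative `∇_D` on rational derivations: `(∇_D ξ)(α) = D(ξ(α))`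
for `α ∈ V*`, i.e. `∇_D ξ = Σ_x D(ξ(x_x)) ∂_x`. -/
def nabDer (pd : Fin ℓ → Derivation ℝ (Ffield ℓ) (Ffield ℓ))
    (D : Derivation ℝ (Ffield ℓ) (Ffield ℓ))
    (ξ : Derivation ℝ (Ffield ℓ) (Ffield ℓ)) : Derivation ℝ (Ffield ℓ) (Ffield ℓ) :=
  ∑ x, D (ξ (XF x)) • pd x

end CoxeterFormalization

section Statements

variable {ℓ t : ℕ}

/-! ### Linear forms are pairwise coprime irreducibles. -/

lemma coeff_single_linForm (a : Fin ℓ → ℝ) (i : Fin ℓ) :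
    (linForm a).coeff (Finsupp.single i 1) = a i := by
  classical
  simp only [linForm, coeff_sum, coeff_C_mul, coeff_X, Finsupp.single_left_inj one_ne_zero]
  simp

lemma irreducible_linForm {a : Fin ℓ → ℝ} (ha : a ≠ 0) : Irreducible (linForm a) := by
  obtain ⟨i, hi⟩ := Function.ne_iff.mp ha
  have hne : linForm a ≠ 0 := fun h => hi (by rw [← coeff_single_linForm a i, h]; simp)
  have hhom : (linForm a).IsHomogeneous 1 :=
    IsHomogeneous.sum _ _ _ fun x _ => by
      simpa using (isHomogeneous_C _ (a x)).mul (isHomogeneous_X ℝ x)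
  refine irreducible_of_totalDegree_eq_one (hhom.totalDegree hne) fun r hr => ?_
  have h := hr (Finsupp.single i 1)
  rw [coeff_single_linForm] at h
  exact isUnit_iff_ne_zero.mpr (ne_zero_of_dvd_ne_zero hi h)

lemma exists_smul_of_linForm_dvd {a b : Fin ℓ → ℝ} (ha : a ≠ 0) (hb : b ≠ 0)
    (h : linForm a ∣ linForm b) : ∃ c : ℝ, b = c • a := by
  obtain ⟨u, hu⟩ := (irreducible_linForm ha).associated_of_dvd (irreducible_linForm hb) h
  obtain ⟨c, -, hc⟩ := isUnit_iff_eq_C_of_isReduced.mp u.isUnit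
  refine ⟨c, funext fun i => ?_⟩
  rw [← coeff_single_linForm b, ← hu, hc, mul_comm, coeff_C_mul, coeff_single_linForm]
  simp

/-! ### Regular functions form a subring of `F`. -/

/-- `S` as a subring of `F`. -/
noncomputable def regularSubring (ℓ : ℕ) : Subring (Ffield ℓ) := (algebraMap (Spoly ℓ) (Ffield ℓ)).range

lemma toF_mem (p : Spoly ℓ) : toF p ∈ regularSubring ℓ := ⟨p, rfl⟩

lemma linF_ne_zero {a : Fin ℓ → ℝ} (ha : a ≠ 0) : linF a ≠ 0 := by
  simpa [linF, toF] using (irreducible_linForm ha).ne_zero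

lemma QF_eq_prod (A : Finset (Fin ℓ → ℝ)) : QF A = ∏ a ∈ A, linF a := by
  simp [QF, linF, toF, map_prod]

lemma QF_div_linF {A : Finset (Fin ℓ → ℝ)} (hA0 : ∀ a ∈ A, a ≠ 0) {a : Fin ℓ → ℝ} (ha : a ∈ A) :
    QF A / linF a = ∏ b ∈ A.erase a, linF b := by
  rw [QF_eq_prod, ← Finset.mul_prod_erase A _ ha, mul_div_cancel_left₀ _ (linF_ne_zero (hA0 a ha))]

lemma linF_zpow_mem {a : Fin ℓ → ℝ} {k : ℤ} (hk : 0 ≤ k) : linF a ^ k ∈ regularSubring ℓ := by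
  lift k to ℕ using hk
  rw [zpow_natCast]
  exact pow_mem (toF_mem _) k

lemma prod_linF_zpow_mem {s : Finset (Fin ℓ → ℝ)} {m : (Fin ℓ → ℝ) → ℤ}
    (hm : ∀ a ∈ s, 0 ≤ m a) : ∏ a ∈ s, linF a ^ m a ∈ regularSubring ℓ :=
  prod_mem fun a ha => linF_zpow_mem (hm a ha)

/-- A power of `∏ α` divided by `∏ α ^ m` is regular once the exponent dominates `m`. -/
lemma exists_prod_linF_pow_eq {s : Finset (Fin ℓ → ℝ)} (h0 : ∀ a ∈ s, a ≠ 0)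
    {m : (Fin ℓ → ℝ) → ℤ} {N : ℕ} (hN : ∀ a ∈ s, m a ≤ N) :
    ∃ r ∈ regularSubring ℓ, (∏ a ∈ s, linF a) ^ N = r * ∏ a ∈ s, linF a ^ m a := by
  refine ⟨∏ a ∈ s, linF a ^ ((N : ℤ) - m a),
    prod_linF_zpow_mem fun a ha => sub_nonneg.mpr (hN a ha), ?_⟩
  rw [← Finset.prod_mul_distrib, ← Finset.prod_pow]
  refine Finset.prod_congr rfl fun a ha => ?_
  rw [← zpow_add₀ (linF_ne_zero (h0 a ha)), sub_add_cancel, zpow_natCast]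

/-- A rational function with poles only along `A` and without pole along each member of `A`
is regular. -/
lemma regular_of_locally_regular {A : Finset (Fin ℓ → ℝ)} (hA0 : ∀ a ∈ A, a ≠ 0)
    (hAprop : ∀ a ∈ A, ∀ b ∈ A, (∃ c : ℝ, a = c • b) → a = b) {N : ℕ} {f : Ffield ℓ}
    (hf : QF A ^ N * f ∈ regularSubring ℓ)
    (hloc : ∀ a ∈ A, (QF A / linF a) ^ N * f ∈ regularSubring ℓ) :
    f ∈ regularSubring ℓ := by
  obtain ⟨p, hp⟩ := hf
  have hinj := IsFractionRing.injective (Spoly ℓ) (Ffield ℓ)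
  have hdvd : ∏ a ∈ A, linForm a ^ N ∣ p := by
    refine Finset.prod_dvd_of_isRelPrime (fun a ha b hb hab => ?_) fun a ha => ?_
    · refine IsRelPrime.pow ((irreducible_linForm (hA0 a ha)).isRelPrime_iff_not_dvd.mpr
        fun h => hab ?_)
      exact (hAprop b hb a ha (exists_smul_of_linForm_dvd (hA0 a ha) (hA0 b hb) h)).symm
    · obtain ⟨r, hr⟩ := hloc a ha
      refine ⟨r, hinj ?_⟩
      rw [hp, map_mul, map_pow, hr, ← mul_assoc, ← mul_pow]
      congr 2
      exact (mul_div_cancel₀ (QF A) (linF_ne_zero (hA0 a ha))).symm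
  obtain ⟨r, rfl⟩ := hdvd
  refine ⟨r, ?_⟩
  have hQ : QF A ^ N ≠ 0 :=
    pow_ne_zero _ (QF_eq_prod A ▸ Finset.prod_ne_zero_iff.mpr fun a ha => linF_ne_zero (hA0 a ha))
  apply mul_left_cancel₀ hQ
  rw [← hp, map_mul, Finset.prod_pow, map_pow]
  rfl

/-- `|a|² ω` is `I*(dα, ω) dα` plus the contraction of `dα ∧ ω` with `a`. -/
lemma norm_sq_mul_eq (a : Fin ℓ → ℝ) (ω : OmF ℓ) (y : Fin ℓ) :
    cF (∑ x, a x * a x) * ω y = cF (a y) * (∑ x, cF (a x) * ω x)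
      + ∑ x, cF (a x) * (cF (a x) * ω y - cF (a y) * ω x) := by
  have h : (cF (∑ x, a x * a x) : Ffield ℓ) = ∑ x, cF (a x) * cF (a x) := by
    simp [cF, toF, map_sum]
  rw [h, Finset.sum_mul, Finset.mul_sum, ← Finset.sum_add_distrib]
  exact Finset.sum_congr rfl fun x _ => by ring

lemma mem_of_contractions_mem {a : Fin ℓ → ℝ} (ha : a ≠ 0) {ω : OmF ℓ} {u : Ffield ℓ}
    (hI : u * ∑ x, cF (a x) * ω x ∈ regularSubring ℓ)
    (hw : ∀ x y, u * (cF (a x) * ω y - cF (a y) * ω x) ∈ regularSubring ℓ) (y : Fin ℓ) :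
    u * ω y ∈ regularSubring ℓ := by
  have hs : ∑ x, a x * a x ≠ 0 := fun h =>
    ha (dotProduct_self_eq_zero.mp h)
  have hc : (cF (∑ x, a x * a x)⁻¹ : Ffield ℓ) * cF (∑ x, a x * a x) = 1 := by
    simp only [cF, toF]
    rw [← map_mul, ← C_mul, inv_mul_cancel₀ hs, C_1, map_one]
  have key : u * ω y = cF (∑ x, a x * a x)⁻¹ * (cF (a y) * (u * ∑ x, cF (a x) * ω x)
      + ∑ x, cF (a x) * (u * (cF (a x) * ω y - cF (a y) * ω x))) := by
    have h1 : ∑ x, cF (a x) * (u * (cF (a x) * ω y - cF (a y) * ω x))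
        = u * ∑ x, cF (a x) * (cF (a x) * ω y - cF (a y) * ω x) := by
      rw [Finset.mul_sum]; exact Finset.sum_congr rfl fun x _ => by ring
    rw [h1, mul_left_comm (cF (a y)), ← mul_add, ← norm_sq_mul_eq]
    linear_combination -(u * ω y) * hc
  rw [key]
  exact mul_mem (toF_mem _) (add_mem (mul_mem (toF_mem _) hI)
    (sum_mem fun x _ => mul_mem (toF_mem _) (hw x y)))

lemma pow_mul_mem_of_le {u f : Ffield ℓ} {n N : ℕ} (hu : u ∈ regularSubring ℓ) (h : n ≤ N)
    (hf : u ^ n * f ∈ regularSubring ℓ) : u ^ N * f ∈ regularSubring ℓ := by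
  rw [← Nat.sub_add_cancel h, pow_add, mul_assoc]
  exact mul_mem (pow_mem hu _) hf

lemma QF_mem (A : Finset (Fin ℓ → ℝ)) : QF A ∈ regularSubring ℓ := toF_mem _

lemma QF_div_linF_mem {A : Finset (Fin ℓ → ℝ)} (hA0 : ∀ a ∈ A, a ≠ 0) {a : Fin ℓ → ℝ}
    (ha : a ∈ A) : QF A / linF a ∈ regularSubring ℓ := by
  rw [QF_div_linF hA0 ha]
  exact prod_mem fun b _ => toF_mem _

lemma ziegler_of_mem_OmegaMult {A : Finset (Fin ℓ → ℝ)}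
    (hA0 : ∀ a ∈ A, a ≠ 0)
    (hAprop : ∀ a ∈ A, ∀ b ∈ A, (∃ c : ℝ, a = c • b) → a = b)
    {m : (Fin ℓ → ℝ) → ℤ} (hm : ∀ a ∈ A, 0 ≤ m a) {ω : OmF ℓ} (hω : ω ∈ OmegaMult A m) :
    (∀ x, QmF A m * ω x ∈ regularSubring ℓ) ∧
      ∀ a ∈ A, ∀ x y, (∏ b ∈ A.erase a, linF b ^ m b) *
        (cF (a x) * ω y - cF (a y) * ω x) ∈ regularSubring ℓ := by
  obtain ⟨⟨N₁, hQ, hW⟩, N₂, hI⟩ := hω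
  set N := max N₁ N₂
  have hQ' : ∀ x, QF A ^ N * ω x ∈ regularSubring ℓ := fun x =>
    pow_mul_mem_of_le (QF_mem A) (le_max_left _ _) (hQ x)
  have hW' : ∀ a ∈ A, ∀ x y, (QF A / linF a) ^ N * (cF (a x) * ω y - cF (a y) * ω x)
      ∈ regularSubring ℓ := fun a ha x y =>
    pow_mul_mem_of_le (QF_div_linF_mem hA0 ha) (le_max_left _ _) (hW a ha x y)
  have hpole : ∀ a ∈ A, ∀ y, (QF A / linF a) ^ N * linF a ^ m a * ω y ∈ regularSubring ℓ := by
    intro a ha y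
    refine mem_of_contractions_mem (hA0 a ha) ?_ (fun x y => ?_) y
    · rw [mul_assoc]
      refine pow_mul_mem_of_le (QF_div_linF_mem hA0 ha) (le_max_right _ _) ?_
      rw [← mul_assoc]
      exact hI a ha
    · rw [mul_right_comm]
      exact mul_mem (hW' a ha x y) (linF_zpow_mem (hm a ha))
  have hm' : ∀ {s : Finset (Fin ℓ → ℝ)}, s ⊆ A → ∀ b ∈ s, 0 ≤ m b := fun hs b hb => hm b (hs hb)
  refine ⟨fun x => ?_, fun a ha x y => ?_⟩
  · refine regular_of_locally_regular hA0 hAprop (N := N) ?_ fun a ha => ?_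
    · rw [mul_left_comm]
      exact mul_mem (prod_linF_zpow_mem hm) (hQ' x)
    · rw [QmF, ← Finset.mul_prod_erase A _ ha]
      convert mul_mem (prod_linF_zpow_mem (hm' (A.erase_subset a))) (hpole a ha x) using 1
      ring
  · refine regular_of_locally_regular hA0 hAprop (N := N) ?_ fun b hb => ?_
    · convert mul_mem (prod_linF_zpow_mem (hm' (A.erase_subset a)))
        (sub_mem (mul_mem (toF_mem (C (a x))) (hQ' y)) (mul_mem (toF_mem (C (a y))) (hQ' x))) using 1
      simp only [cF]
      ring
    · by_cases hab : b = a
      · subst hab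
        rw [mul_left_comm]
        exact mul_mem (prod_linF_zpow_mem (hm' (A.erase_subset b))) (hW' b hb x y)
      · rw [← Finset.mul_prod_erase (A.erase a) _ (Finset.mem_erase.mpr ⟨hab, hb⟩)]
        convert mul_mem (prod_linF_zpow_mem
            (hm' (((A.erase a).erase_subset b).trans (A.erase_subset a))))
          (sub_mem (mul_mem (toF_mem (C (a x))) (hpole b hb y))
            (mul_mem (toF_mem (C (a y))) (hpole b hb x))) using 1
        simp only [cF]
        ring

lemma mem_OmegaMult_of_ziegler {A : Finset (Fin ℓ → ℝ)} (hA0 : ∀ a ∈ A, a ≠ 0)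
    {m : (Fin ℓ → ℝ) → ℤ} {ω : OmF ℓ} (hQ : ∀ x, QmF A m * ω x ∈ regularSubring ℓ)
    (hW : ∀ a ∈ A, ∀ x y, (∏ b ∈ A.erase a, linF b ^ m b) *
      (cF (a x) * ω y - cF (a y) * ω x) ∈ regularSubring ℓ) :
    ω ∈ OmegaMult A m := by
  obtain ⟨N, hN⟩ : ∃ N : ℕ, ∀ a ∈ A, m a ≤ N :=
    ⟨A.sup fun a => (m a).toNat, fun a ha => (Int.self_le_toNat _).trans
      (by exact_mod_cast Finset.le_sup (f := fun a => (m a).toNat) ha)⟩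
  refine ⟨⟨N, fun x => ?_, fun a ha x y => ?_⟩, N, fun a ha => ?_⟩
  · obtain ⟨r, hr, h⟩ := exists_prod_linF_pow_eq hA0 hN
    rw [QF_eq_prod, h, mul_assoc]
    exact mul_mem hr (hQ x)
  all_goals
    obtain ⟨r, hr, h⟩ := exists_prod_linF_pow_eq (s := A.erase a)
      (fun b hb => hA0 b (Finset.mem_of_mem_erase hb))
      (fun b hb => hN b (Finset.mem_of_mem_erase hb))
    rw [QF_div_linF hA0 ha, h, mul_assoc]
  · exact mul_mem hr (hW a ha x y)
  · have hsum : (∏ b ∈ A.erase a, linF b ^ m b) * (linF a ^ m a) * ∑ x, cF (a x) * ω x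
        = ∑ x, cF (a x) * (QmF A m * ω x) := by
      rw [Finset.prod_erase_mul A _ ha, Finset.mul_sum]
      exact Finset.sum_congr rfl fun x _ => mul_left_comm _ _ _
    rw [mul_assoc r, ← mul_assoc (∏ b ∈ A.erase a, linF b ^ m b), hsum]
    exact mul_mem hr (sum_mem fun x _ => mul_mem (toF_mem _) (hQ x))

/-- for a nonnegative multiplicity `m`, `Ω(A,m)` coincides with
Ziegler's module of logarithmic forms with multiplicity. -/
theorem stmt16 (A : Finset (Fin ℓ → ℝ))
    (hA0 : ∀ a ∈ A, a ≠ 0)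
    (hAprop : ∀ a ∈ A, ∀ b ∈ A, (∃ c : ℝ, a = c • b) → a = b)
    (m : (Fin ℓ → ℝ) → ℤ) (hm : ∀ a ∈ A, 0 ≤ m a) :
    OmegaMult A m =
      {ω : OmF ℓ | (∀ x, QmF A m * ω x ∈ Sreg ℓ) ∧
        ∀ a ∈ A, ∀ x y,
          (∏ b ∈ A.erase a, linF b ^ m b) * (cF (a x) * ω y - cF (a y) * ω x) ∈ Sreg ℓ} := by
  ext ω
  exact ⟨ziegler_of_mem_OmegaMult hA0 hAprop hm,
    fun h => mem_OmegaMult_of_ziegler hA0 h.1 h.2⟩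

end Statements
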